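/- For every sufficiently large natural number N, there exists a glue-restricted tile assembly system 𝒯 = (T_N, σ, 1) (an rgTAS) such that 𝒯 is directed, the N×N square S_N strictly self-assembles in 𝒯, and |T_N| < 2N − 1. (In particular, the Rothemund–Winfree lower bound of 2N−1 tile types for temperature-1 unique assembly of S_N fails for glue-restricted systems.) -/

import Mathlib

namespace TA

abbrev Pos : Type := ℤ × ℤ

def U2 : Finset Pos := {(0, 1), (1, 0), (0, -1), (-1, 0)}

structure Tile where
  col : Pos → ℕ
  str : Pos → ℤ

noncomputable instance : DecidableEq Tile := Classical.decEq _

/-- Interaction strength between side `u` of tile `t` and side `-u` of tile `t'`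
(diagonal glue function: glues interact only if both color and strength match). -/
def interaction (t t' : Tile) (u : Pos) : ℤ :=
  if t.col u = t'.col (-u) ∧ t.str u = t'.str (-u) then t.str u else 0

abbrev Assembly : Type := Pos → Option Tile

def adom (α : Assembly) : Set Pos := {x | α x ≠ none}

/-- Total binding strength experienced by tile `t` when placed at position `m` in `α`. -/
def bindStrength (α : Assembly) (t : Tile) (m : Pos) : ℤ :=
  ∑ u ∈ U2, (α (m + u)).elim 0 (fun t' => interaction t t' u)

/-- A tile assembly system: a finite tile set, a single seed tile (placed at the
origin), and a temperature. -/
structure TAS where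
  tiles : Finset Tile
  seedTile : Tile
  temp : ℤ
  seed_mem : seedTile ∈ tiles

def TAS.seed (𝒯 : TAS) : Assembly := fun x => if x = (0, 0) then some 𝒯.seedTile else none

/-- Tile `t` may be placed at empty position `m` of `α` if the sum of its
interaction strengths with adjacent tiles is at least the temperature
(irreversible model: negative glues count toward the sum). -/
def CanPlace (𝒯 : TAS) (α : Assembly) (m : Pos) (t : Tile) : Prop :=
  t ∈ 𝒯.tiles ∧ α m = none ∧ 𝒯.temp ≤ bindStrength α t m

def Step (𝒯 : TAS) (α β : Assembly) : Prop :=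
  ∃ m t, CanPlace 𝒯 α m t ∧ β = Function.update α m (some t)

/-- A (possibly stuttering) assembly sequence starting at the seed. -/
def AsmSeq (𝒯 : TAS) (f : ℕ → Assembly) : Prop :=
  f 0 = 𝒯.seed ∧ ∀ i, Step 𝒯 (f i) (f (i + 1)) ∨ f (i + 1) = f i

/-- `α` is the result (union) of the assembly sequence `f`. -/
def IsResult (f : ℕ → Assembly) (α : Assembly) : Prop :=
  ∀ x, (∃ i, f i x = α x ∧ f i x ≠ none) ∨ (α x = none ∧ ∀ i, f i x = none)

def Producible (𝒯 : TAS) (α : Assembly) : Prop :=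
  ∃ f, AsmSeq 𝒯 f ∧ IsResult f α

/-- No tile can be added to `α`. -/
def Stuck (𝒯 : TAS) (α : Assembly) : Prop := ∀ m t, ¬ CanPlace 𝒯 α m t

def Terminal (𝒯 : TAS) (α : Assembly) : Prop := Producible 𝒯 α ∧ Stuck 𝒯 α

/-- A TAS is directed if it has exactly one terminal assembly. -/
def DirectedTAS (𝒯 : TAS) : Prop := ∃! α, Terminal 𝒯 α

/-- `X` strictly self-assembles in `𝒯`: the domain of every terminal assembly is a
translate of `X`. -/
def StrictlySelfAssembles (𝒯 : TAS) (X : Set Pos) : Prop :=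
  ∀ α, Terminal 𝒯 α → ∃ v : Pos, adom α = (fun p => p + v) '' X

/-- Every glue strength lies in {-1,0,1}, and there is exactly one glue color of
strength `-1`. -/
def GlueRestricted (T : Finset Tile) : Prop :=
  (∀ t ∈ T, ∀ u ∈ U2, t.str u ∈ ({-1, 0, 1} : Set ℤ)) ∧
  (∃! c : ℕ, ∃ t ∈ T, ∃ u ∈ U2, t.col u = c ∧ t.str u = -1)

/-- A glue-restricted temperature-1 TAS. -/
def IsRgTAS (𝒯 : TAS) : Prop := GlueRestricted 𝒯.tiles ∧ 𝒯.temp = 1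

/-- The `N × N` square `{0,…,N-1} × {0,…,N-1}`. -/
def SN (N : ℕ) : Set Pos := {p : Pos | 0 ≤ p.1 ∧ p.1 < (N : ℤ) ∧ 0 ≤ p.2 ∧ p.2 < (N : ℤ)}

/-- Give every negative-strength glue of `t` strength `-s` instead. -/
def reStr (s : ℤ) (t : Tile) : Tile := ⟨t.col, fun u => if t.str u < 0 then -s else t.str u⟩

/-- A complete run: steps happen as long as possible, and once stuck the sequence
stutters.  A TAS "admits exactly one assembly sequence" iff `∃! f, RunSeq 𝒯 f`. -/
def RunSeq (𝒯 : TAS) (f : ℕ → Assembly) : Prop :=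
  f 0 = 𝒯.seed ∧ ∀ i, Step 𝒯 (f i) (f (i + 1)) ∨ (Stuck 𝒯 (f i) ∧ f (i + 1) = f i)

/-- `u` is an input side of position `x` in the assembly sequence `f`. -/
def InSide (f : ℕ → Assembly) (x u : Pos) : Prop :=
  ∃ i t t', f i x = none ∧ f (i + 1) x = some t ∧ f i (x + u) = some t' ∧
    0 < interaction t t' u

/-- A zig-zag TAS: temperature 2, directed, unique assembly sequence, and no tile
ever has `(0,1)` as an input side. -/
def ZigZag (𝒯 : TAS) : Prop :=
  𝒯.temp = 2 ∧ DirectedTAS 𝒯 ∧ (∃! f, RunSeq 𝒯 f) ∧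
    ∀ f, RunSeq 𝒯 f → ∀ x, ¬ InSide f x (0, 1)

def CompactZigZag (𝒯 : TAS) : Prop :=
  ZigZag 𝒯 ∧ ∀ α, Terminal 𝒯 α → ∀ x t, α x = some t → ∀ u ∈ U2, t.str u + t.str (-u) < 4

/-- `𝒮` path simulates `𝒯` at scale factor `c`: `𝒮` has a unique assembly
sequence, and there are segment indices `I` (with `c` the maximal segment length,
attained) and a map `F` from producible assemblies of `𝒮` to producible assemblies
of `𝒯` sending the result of the `j`-th segment of `𝒮`'s run to the `j`-th assembly
of `𝒯`'s run. -/
def PathSimulates (𝒮 𝒯 : TAS) (c : ℕ) : Prop :=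
  (∃! g, RunSeq 𝒮 g) ∧
  ∀ f g, RunSeq 𝒯 f → RunSeq 𝒮 g →
    ∃ I : ℕ → ℕ, I 0 = 0 ∧ StrictMono I ∧
      (∀ j, I (j + 1) - I j ≤ c) ∧ (∃ j, I (j + 1) - I j = c) ∧
      ∃ F : Assembly → Assembly,
        (∀ β, Producible 𝒮 β → Producible 𝒯 (F β)) ∧
        ∀ j, F (g (I (j + 1) - 1)) = f j

end TA

namespace TA

/-- A tile type given by its north, east, south and west glue. Glue `0` is the null glue,
glue `1` is the unique glue of strength `-1`, and every other glue has strength `1`. -/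
structure Quad where
  n : ℕ
  e : ℕ
  s : ℕ
  w : ℕ
deriving DecidableEq

/-- The four directions: north, east, south, west. -/
def dir : Fin 4 → Pos
  | 0 => (0, 1)
  | 1 => (1, 0)
  | 2 => (0, -1)
  | 3 => (-1, 0)

/-- The glue on a side of a tile type. -/
def Quad.side (q : Quad) : Fin 4 → ℕ
  | 0 => q.n
  | 1 => q.e
  | 2 => q.s
  | 3 => q.w

/-- The strength of a glue. -/
def glueSign : ℕ → ℤ
  | 0 => 0
  | 1 => -1
  | _ + 2 => 1

/-- The glue of `q` in a direction given as a vector. -/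
def Quad.toward (q : Quad) (u : Pos) : ℕ :=
  if u = dir 0 then q.n else if u = dir 1 then q.e else if u = dir 2 then q.s
  else if u = dir 3 then q.w else 0

/-- The tile described by `q`. -/
def toTile (q : Quad) : Tile := ⟨q.toward, fun u => glueSign (q.toward u)⟩

lemma neg_dir (d : Fin 4) : -dir d = dir (d + 2) := by
  fin_cases d <;> rfl

lemma dir_add_two (d : Fin 4) : dir d + dir (d + 2) = 0 := by
  fin_cases d <;> rfl

lemma add_two_add_two (d : Fin 4) : d + 2 + 2 = d := by
  fin_cases d <;> rfl

lemma dir_injective : Function.Injective dir := by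
  decide

lemma toward_dir (q : Quad) (d : Fin 4) : q.toward (dir d) = q.side d := by
  fin_cases d <;> rfl

lemma sum_U2 (f : Pos → ℤ) : ∑ u ∈ U2, f u = ∑ d, f (dir d) := by
  have h : U2 = Finset.univ.image dir := by decide
  rw [h, Finset.sum_image dir_injective.injOn]

lemma mem_U2 {u : Pos} : u ∈ U2 ↔ ∃ d, dir d = u := by
  have h : U2 = Finset.univ.image dir := by decide
  simp [h]

lemma interaction_toTile (q q' : Quad) (d : Fin 4) :
    interaction (toTile q) (toTile q') (dir d) =
      if q.side d = q'.side (d + 2) then glueSign (q.side d) else 0 := by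
  simp only [interaction, toTile, neg_dir, toward_dir]
  by_cases h : q.side d = q'.side (d + 2) <;> simp [h]

lemma glueSign_le_one (g : ℕ) : glueSign g ≤ 1 := by
  match g with
  | 0 => simp [glueSign]
  | 1 => simp [glueSign]
  | _ + 2 => simp [glueSign]

lemma glueSign_pos {g : ℕ} : 0 < glueSign g ↔ 2 ≤ g := by
  match g with
  | 0 => simp [glueSign]
  | 1 => simp [glueSign]
  | _ + 2 => simp [glueSign]

lemma glueSign_neg {g : ℕ} : glueSign g < 0 ↔ g = 1 := by
  match g with
  | 0 => simp [glueSign]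
  | 1 => simp [glueSign]
  | _ + 2 => simp [glueSign]

/-- A finite target assembly `tgt` over `tiles`, together with a tree structure `par` on its
positions, rooted at the origin, such that every tile attaches to its parent, no other tile can
take its place once its ancestors are present, and no two tiles of the target repel each other. -/
structure Blueprint where
  tiles : Finset Quad
  tgt : Pos → Option Quad
  par : Pos → Pos
  seed : Quad
  tgt_zero : tgt 0 = some seed
  par_zero : par 0 = 0
  mem_tiles : ∀ {p q}, tgt p = some q → q ∈ tiles
  finite : {p | tgt p ≠ none}.Finite
  chain : ∀ {p}, tgt p ≠ none → ∃ k, par^[k] p = 0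
  par_spec : ∀ {p q}, tgt p = some q → p ≠ 0 → ∃ d q', par p = p + dir d ∧
    tgt (p + dir d) = some q' ∧ 2 ≤ q.side d ∧ q'.side (d + 2) = q.side d
  emit : ∀ {p q d}, tgt p = some q → 2 ≤ q.side d → (∃ k, par^[k] p = p + dir d) ∨
    (tgt (p + dir d) ≠ none ∧ par (p + dir d) = p) ∨ ∀ t ∈ tiles, t.side (d + 2) ≠ q.side d
  fork : ∀ {p q d q' t}, tgt p = some q → p ≠ 0 → par p = p + dir d →
    tgt (p + dir d) = some q' → t ∈ tiles → 2 ≤ t.side d → t.side d = q'.side (d + 2) → t = q ∨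
      ∃ v r, t.side v = 1 ∧ tgt (p + dir v) = some r ∧ r.side (v + 2) = 1 ∧
        ∃ k, par^[k] p = p + dir v
  calm : ∀ {p q d q'}, tgt p = some q → tgt (p + dir d) = some q' → q.side d = 1 →
    q'.side (d + 2) ≠ 1

namespace Blueprint

variable (B : Blueprint)

/-- The tile assembly system of a blueprint. -/
noncomputable def tas : TAS where
  tiles := B.tiles.image toTile
  seedTile := toTile B.seed
  temp := 1
  seed_mem := Finset.mem_image_of_mem _ (B.mem_tiles B.tgt_zero)

/-- The target assembly of a blueprint. -/
def target : Assembly := fun p => (B.tgt p).map toTile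

/-- Subassemblies of the target closed under parents. -/
def Good (β : Assembly) : Prop :=
  β 0 ≠ none ∧ ∀ p t, β p = some t → (∃ q, B.tgt p = some q ∧ t = toTile q) ∧ β (B.par p) ≠ none

variable {B} {β γ : Assembly}

lemma Good.tgt_ne_none (h : B.Good β) {p : Pos} (hp : β p ≠ none) : B.tgt p ≠ none := by
  obtain ⟨t, ht⟩ := Option.ne_none_iff_exists'.1 hp
  obtain ⟨⟨q, hq, -⟩, -⟩ := h.2 p t ht
  simp [hq]

lemma Good.eq_target (h : B.Good β) {p : Pos} (hp : β p ≠ none) : β p = B.target p := by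
  obtain ⟨t, ht⟩ := Option.ne_none_iff_exists'.1 hp
  obtain ⟨⟨q, hq, rfl⟩, -⟩ := h.2 p t ht
  simp [ht, target, hq]

lemma Good.iterate (h : B.Good β) {p : Pos} (hp : β p ≠ none) (k : ℕ) :
    β (B.par^[k] p) ≠ none := by
  induction k generalizing p with
  | zero => simpa using hp
  | succ k ih =>
    obtain ⟨t, ht⟩ := Option.ne_none_iff_exists'.1 hp
    exact ih (h.2 p t ht).2

/-- The contribution of direction `d` to the binding strength of `q` at `m`. -/
def pull (β : Assembly) (q : Quad) (m : Pos) (d : Fin 4) : ℤ :=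
  (β (m + dir d)).elim 0 fun t' => interaction (toTile q) t' (dir d)

lemma bindStrength_toTile (q : Quad) (m : Pos) :
    bindStrength β (toTile q) m = ∑ d, pull β q m d := by
  rw [bindStrength, sum_U2]
  rfl

lemma Good.pull_eq (h : B.Good β) (q : Quad) {m : Pos} {d : Fin 4} {q' : Quad}
    (hd : β (m + dir d) ≠ none) (hq' : B.tgt (m + dir d) = some q') :
    pull β q m d = if q.side d = q'.side (d + 2) then glueSign (q.side d) else 0 := by
  rw [pull, h.eq_target hd, target, hq', ← interaction_toTile]
  rfl

lemma Good.pull_ne_zero (h : B.Good β) {q : Quad} {m : Pos} {d : Fin 4}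
    (hd : pull β q m d ≠ 0) : β (m + dir d) ≠ none ∧ ∃ q', B.tgt (m + dir d) = some q' ∧
      q.side d = q'.side (d + 2) ∧ pull β q m d = glueSign (q.side d) := by
  have h1 : β (m + dir d) ≠ none := fun h1 => hd (by simp [pull, h1])
  obtain ⟨q', hq'⟩ := Option.ne_none_iff_exists'.1 (h.tgt_ne_none h1)
  have h2 := h.pull_eq q h1 hq'
  refine ⟨h1, q', hq', ?_⟩
  by_cases h3 : q.side d = q'.side (d + 2)
  · exact ⟨h3, by rw [h2, if_pos h3]⟩
  · exact absurd (by rw [h2, if_neg h3]) hd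

lemma Good.pull_le_one (h : B.Good β) (q : Quad) (m : Pos) (d : Fin 4) : pull β q m d ≤ 1 := by
  by_cases hd : pull β q m d = 0
  · omega
  · obtain ⟨-, q', -, -, h3⟩ := h.pull_ne_zero hd
    rw [h3]
    exact glueSign_le_one _

/-- A tile is only ever attracted by the parent of its position. -/
lemma Good.par_of_pull_pos (h : B.Good β) {q : Quad} (hq : q ∈ B.tiles) {m : Pos}
    (hm : β m = none) {d : Fin 4} (hd : 0 < pull β q m d) :
    B.tgt m ≠ none ∧ B.par m = m + dir d := by
  obtain ⟨h1, q', hq', h2, h3⟩ := h.pull_ne_zero hd.ne'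
  rw [h3, glueSign_pos] at hd
  have hback : m + dir d + dir (d + 2) = m := by rw [add_assoc, dir_add_two, add_zero]
  rcases B.emit hq' (h2 ▸ hd) with ⟨k, hk⟩ | ⟨h4, h5⟩ | h4
  · exact absurd (hback ▸ hk ▸ h.iterate h1 k) (by simp [hm])
  · rw [hback] at h4 h5
    exact ⟨h4, h5⟩
  · exact absurd (by rw [add_two_add_two, h2]) (h4 q hq)

/-- Only the intended tile can be placed. -/
lemma Good.eq_of_canPlace (h : B.Good β) {m : Pos} {t : Tile} (hp : CanPlace B.tas β m t) :
    ∃ q, B.tgt m = some q ∧ t = toTile q ∧ β (B.par m) ≠ none := by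
  obtain ⟨ht, hm, hs⟩ := hp
  obtain ⟨q₀, hq₀, rfl⟩ := Finset.mem_image.1 ht
  rw [bindStrength_toTile] at hs
  replace hs : 1 ≤ ∑ d, pull β q₀ m d := hs
  obtain ⟨d, -, hd⟩ : ∃ d ∈ Finset.univ, 0 < pull β q₀ m d := by
    by_contra! hc
    have := Finset.sum_nonpos hc
    omega
  obtain ⟨h1, h2⟩ := h.par_of_pull_pos hq₀ hm hd
  obtain ⟨q, hq⟩ := Option.ne_none_iff_exists'.1 h1
  obtain ⟨h3, q', hq', h4, h5⟩ := h.pull_ne_zero hd.ne'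
  have hm0 : m ≠ 0 := by
    rintro rfl
    exact h.1 hm
  refine ⟨q, hq, ?_, h2 ▸ h3⟩
  have hg : 2 ≤ q₀.side d := by rwa [h5, glueSign_pos] at hd
  rcases B.fork hq hm0 h2 hq' hq₀ hg h4 with rfl | ⟨v, r, hv, hr, hr1, k, hk⟩
  · rfl
  exfalso
  have hrep : pull β q₀ m v = -1 := by
    have : β (m + dir v) ≠ none := by
      rw [← hk]
      cases k with
      | zero =>
        exfalso
        have h0 : m + 0 = m + dir v := by simpa using hk
        have := add_left_cancel h0
        revert this
        fin_cases v <;> decide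
      | succ k => exact h.iterate (p := B.par m) (h2 ▸ h3) k
    rw [h.pull_eq q₀ this hr, hv, hr1, if_pos rfl]
    rfl
  have hvd : v ≠ d := by
    rintro rfl
    omega
  have hle : ∑ d', pull β q₀ m d' ≤ ∑ d', if d' = d then 1 else if d' = v then -1 else 0 := by
    refine Finset.sum_le_sum fun d' _ => ?_
    split_ifs with e1 e2
    · exact h.pull_le_one _ _ _
    · rw [e2, hrep]
    · by_contra! hc
      have := (h.par_of_pull_pos hq₀ hm hc).2
      rw [h2] at this
      exact e1 (dir_injective (add_left_cancel this)).symm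
  have hz : ∀ d v : Fin 4, v ≠ d →
      (∑ d' : Fin 4, if d' = d then (1 : ℤ) else if d' = v then -1 else 0) = 0 := by decide
  rw [hz d v hvd] at hle
  omega

/-- The intended tile can be placed once the parent of its position is present. -/
lemma Good.canPlace (h : B.Good β) {m : Pos} {q : Quad} (hq : B.tgt m = some q)
    (hm : β m = none) (hpar : β (B.par m) ≠ none) : CanPlace B.tas β m (toTile q) := by
  have hm0 : m ≠ 0 := by
    rintro rfl
    exact h.1 hm
  obtain ⟨d, q', h1, h2, h3, h4⟩ := B.par_spec hq hm0
  rw [h1] at hpar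
  refine ⟨Finset.mem_image_of_mem _ (B.mem_tiles hq), hm, ?_⟩
  rw [bindStrength_toTile]
  have h5 : 0 < pull β q m d := by
    rwa [h.pull_eq q hpar h2, if_pos h4.symm, glueSign_pos]
  refine le_trans (show (1 : ℤ) ≤ pull β q m d from h5) ?_
  refine Finset.single_le_sum (f := fun d => pull β q m d) (fun d' _ => ?_) (Finset.mem_univ d)
  by_contra! hc
  obtain ⟨-, r, hr, h6, h7⟩ := h.pull_ne_zero hc.ne
  rw [h7, glueSign_neg] at hc
  exact B.calm hq hr hc (h6 ▸ hc)

lemma Good.step (h : B.Good β) (hs : Step B.tas β γ) : B.Good γ := by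
  obtain ⟨m, t, hp, rfl⟩ := hs
  obtain ⟨q, hq, rfl, hpar⟩ := h.eq_of_canPlace hp
  have mono : ∀ p, β p ≠ none → Function.update β m (some (toTile q)) p ≠ none := by
    intro p hp'
    by_cases e : p = m
    · simp [e]
    · simpa [e] using hp'
  refine ⟨mono _ h.1, fun p t hpt => ?_⟩
  by_cases e : p = m
  · subst e
    simp only [Function.update_self, Option.some.injEq] at hpt
    exact ⟨⟨q, hq, hpt.symm⟩, mono _ hpar⟩
  · rw [Function.update_of_ne e] at hpt
    exact ⟨(h.2 p t hpt).1, mono _ (h.2 p t hpt).2⟩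

lemma seed_apply (p : Pos) : B.tas.seed p = if p = 0 then some (toTile B.seed) else none := rfl

lemma good_seed : B.Good B.tas.seed := by
  refine ⟨by simp [seed_apply], fun p t hp => ?_⟩
  rw [seed_apply] at hp
  split_ifs at hp with e
  subst e
  exact ⟨⟨B.seed, B.tgt_zero, (Option.some.inj hp).symm⟩, by simp [B.par_zero, seed_apply]⟩

lemma Good.eq_target_of_stuck (h : B.Good β) (hs : Stuck B.tas β) : β = B.target := by
  have key : ∀ k p, B.par^[k] p = 0 → B.tgt p ≠ none → β p ≠ none := by
    intro k
    induction k with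
    | zero =>
      rintro p rfl -
      exact h.1
    | succ k ih =>
      intro p hk hp
      by_cases h0 : p = 0
      · subst h0
        exact h.1
      obtain ⟨q, hq⟩ := Option.ne_none_iff_exists'.1 hp
      obtain ⟨d, q', h1, h2, -⟩ := B.par_spec hq h0
      have h3 : β (B.par p) ≠ none := ih _ hk (by simp [h1, h2])
      exact fun h4 => hs p _ (h.canPlace hq h4 h3)
  funext p
  by_cases hp : β p = none
  · rw [hp]
    by_cases ht : B.tgt p = none
    · simp [target, ht]
    · obtain ⟨k, hk⟩ := B.chain ht
      exact absurd hp (key k p hk ht)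
  · exact h.eq_target hp

lemma good_seq {f : ℕ → Assembly} (h0 : B.Good (f 0))
    (hf : ∀ i, Step B.tas (f i) (f (i + 1)) ∨ f (i + 1) = f i) (i : ℕ) : B.Good (f i) := by
  induction i with
  | zero => exact h0
  | succ i ih =>
    rcases hf i with h | h
    · exact ih.step h
    · rwa [h]

lemma good_of_producible (h : Producible B.tas β) : B.Good β := by
  obtain ⟨f, ⟨hf0, hf⟩, hr⟩ := h
  have hg : ∀ i, B.Good (f i) := good_seq (hf0 ▸ good_seed) hf
  have mono : ∀ i p, f i p ≠ none → β p ≠ none := by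
    intro i p hp
    rcases hr p with ⟨j, hj, hj'⟩ | ⟨-, hj⟩
    · rwa [← hj]
    · exact absurd (hj i) hp
  refine ⟨mono 0 _ (hg 0).1, fun p t hp => ?_⟩
  rcases hr p with ⟨i, hi, -⟩ | ⟨hn, -⟩
  · have := (hg i).2 p t (hi.trans hp)
    exact ⟨this.1, mono i _ this.2⟩
  · rw [hp] at hn
    cases hn

lemma Good.exists_seq (h : B.Good β) : ∃ f : ℕ → Assembly, f 0 = β ∧
    (∀ i, Step B.tas (f i) (f (i + 1)) ∨ f (i + 1) = f i) ∧ ∃ n, f n = B.target := by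
  induction hn : ({p | B.tgt p ≠ none} \ {p | β p ≠ none}).ncard using Nat.strong_induction_on
    generalizing β with
  | _ n ih =>
    by_cases hs : Stuck B.tas β
    · exact ⟨fun _ => β, rfl, fun _ => Or.inr rfl, 0, h.eq_target_of_stuck hs⟩
    · simp only [Stuck, not_forall, not_not] at hs
      obtain ⟨m, t, hmt⟩ := hs
      have hstep : Step B.tas β (Function.update β m (some t)) := ⟨m, t, hmt, rfl⟩
      obtain ⟨q, hq, -, -⟩ := h.eq_of_canPlace hmt
      have hlt : ({p | B.tgt p ≠ none} \ {p | Function.update β m (some t) p ≠ none}).ncard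
          < n := by
        rw [← hn]
        refine Set.ncard_lt_ncard ?_ (B.finite.subset Set.sdiff_subset)
        refine (Set.ssubset_iff_of_subset ?_).2 ⟨m, ⟨by simp [hq], by simp [hmt.2.1]⟩, by simp⟩
        rintro p ⟨hp, hp'⟩
        refine ⟨hp, fun h' => hp' ?_⟩
        by_cases e : p = m
        · simp [e]
        · simpa [Function.update_of_ne e] using h'
      obtain ⟨f, hf0, hf, k, hk⟩ := ih _ hlt (h.step hstep) rfl
      refine ⟨fun i => Nat.casesOn i β f, rfl, fun i => ?_, k + 1, hk⟩
      cases i with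
      | zero => exact Or.inl (by simpa [hf0] using hstep)
      | succ i => exact hf i

lemma target_good : B.Good B.target := by
  refine ⟨by simp [target, B.tgt_zero], fun p t hp => ?_⟩
  obtain ⟨q, hq, rfl⟩ := Option.map_eq_some_iff.1 hp
  refine ⟨⟨q, hq, rfl⟩, ?_⟩
  by_cases h0 : p = 0
  · simp [h0, B.par_zero, target, B.tgt_zero]
  · obtain ⟨d, q', h1, h2, -⟩ := B.par_spec hq h0
    simp [h1, target, h2]

lemma terminal_target : Terminal B.tas B.target := by
  refine ⟨?_, fun m t hp => ?_⟩
  · obtain ⟨f, hf0, hf, n, hn⟩ := (good_seed (B := B)).exists_seq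
    refine ⟨f, ⟨hf0, hf⟩, fun p => ?_⟩
    by_cases hp : B.tgt p = none
    · refine Or.inr ⟨by simp [target, hp], fun i => ?_⟩
      by_contra hi
      exact (good_seq (hf0 ▸ good_seed) hf i).tgt_ne_none hi hp
    · exact Or.inl ⟨n, by rw [hn], by simp [hn, target, hp]⟩
  · obtain ⟨q, hq, -⟩ := target_good.eq_of_canPlace hp
    have := hp.2.1
    simp [target, hq] at this

lemma eq_target_of_terminal (h : Terminal B.tas β) : β = B.target :=
  (good_of_producible h.1).eq_target_of_stuck h.2

variable (B)

lemma directed : DirectedTAS B.tas :=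
  ⟨B.target, terminal_target, fun _ => eq_target_of_terminal⟩

lemma strictlySelfAssembles {X : Set Pos} {v : Pos}
    (h : {p | B.tgt p ≠ none} = (fun p => p + v) '' X) : StrictlySelfAssembles B.tas X := by
  intro α hα
  refine ⟨v, ?_⟩
  rw [eq_target_of_terminal hα, ← h]
  ext p
  simp [adom, target]

lemma card_tas_tiles_le : B.tas.tiles.card ≤ B.tiles.card := Finset.card_image_le

lemma isRgTAS (h : ∃ q ∈ B.tiles, ∃ d, q.side d = 1) : IsRgTAS B.tas := by
  refine ⟨⟨fun t ht u hu => ?_, 1, ?_, ?_⟩, rfl⟩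
  · obtain ⟨q, -, rfl⟩ := Finset.mem_image.1 ht
    show glueSign (q.toward u) ∈ _
    match q.toward u with
    | 0 => simp [glueSign]
    | 1 => simp [glueSign]
    | _ + 2 => simp [glueSign]
  · obtain ⟨q, hq, d, hd⟩ := h
    refine ⟨toTile q, Finset.mem_image_of_mem _ hq, dir d, mem_U2.2 ⟨d, rfl⟩, ?_, ?_⟩
    · exact (toward_dir q d).trans hd
    · show glueSign (q.toward (dir d)) = -1
      rw [toward_dir, hd]
      rfl
  · rintro c ⟨t, ht, u, -, hc, hs⟩
    obtain ⟨q, -, rfl⟩ := Finset.mem_image.1 ht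
    rw [← hc]
    refine glueSign_neg.1 ?_
    have : glueSign (q.toward u) = -1 := hs
    show glueSign (q.toward u) < 0
    omega

end Blueprint

/-- The glue below the column tile at height `y`. -/
def colGlue (y : ℕ) : ℕ := 1000 + 2 * y

/-- The glue to the east of the `i`-th tile of the bottom row, counted from the gadget. -/
def rowGlue (i : ℕ) : ℕ := 1001 + 2 * i

/-- The column tile at height `y`. -/
def colQuad (y : ℕ) : Quad := ⟨colGlue (y + 1), 0, colGlue y, 0⟩

/-- The `i`-th tile of the bottom row, counted from the gadget. -/
def rowQuad (i : ℕ) : Quad := ⟨colGlue 1, rowGlue i, 0, rowGlue (i + 1)⟩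

/-- Grid cell `(x, y)` of the gadget as a single number; the gadget has `x ≥ 1` and `y < 7`. -/
def cell (x y : ℕ) : ℕ := 8 * x + y

/-- The lower part of the wall at column `x`, down to the bottom row. -/
def wallFoot (x : ℕ) : List (ℕ × Quad) :=
  [(cell x 3, ⟨102, 0, 103, 0⟩), (cell x 2, ⟨103, 0, 104, 0⟩), (cell x 1, ⟨104, 1, 105, 0⟩),
    (cell x 0, ⟨105, 106, 0, rowGlue 1⟩)]

/-- The seed together with the first wall. -/
def firstWall : List (ℕ × Quad) :=
  [(cell 2 5, ⟨colGlue 6, 0, 1, 100⟩), (cell 1 5, ⟨colGlue 6, 100, 101, 0⟩),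
    (cell 1 4, ⟨101, 0, 102, 0⟩)] ++ wallFoot 1

/-- The outward trip of a block that starts right of the wall at column `x`: a hard-coded bottom
row, a hook at its end, and a crenellated run back to the wall. -/
def outward (x : ℕ) : List (ℕ × Quad) :=
  (cell (x + 1) 0, ⟨0, 200, 0, 106⟩) ::
  (List.range 44).map (fun i => (cell (x + 2 + i) 0, ⟨1, 201 + i, 0, 200 + i⟩)) ++
  [(cell (x + 46) 0, ⟨0, 110, 0, 244⟩), (cell (x + 47) 0, ⟨111, 0, 0, 110⟩),
    (cell (x + 47) 1, ⟨112, 0, 111, 0⟩), (cell (x + 47) 2, ⟨113, 0, 112, 0⟩),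
    (cell (x + 47) 3, ⟨0, 0, 113, 114⟩), (cell (x + 46) 3, ⟨0, 114, 115, 1⟩),
    (cell (x + 46) 2, ⟨115, 0, 116, 0⟩), (cell (x + 46) 1, ⟨116, 0, 0, 117⟩),
    (cell (x + 45) 1, ⟨118, 117, 0, 0⟩), (cell (x + 45) 2, ⟨0, 0, 118, 120⟩)] ++
  (List.range 22).flatMap (fun i =>
    [(cell (x + 44 - 2 * i) 2, ⟨1, 120, 121, 0⟩), (cell (x + 44 - 2 * i) 1, ⟨121, 0, 0, 122⟩)] ++
    if i = 21 then [] else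
      [(cell (x + 43 - 2 * i) 1, ⟨123, 122, 0, 1⟩), (cell (x + 43 - 2 * i) 2, ⟨1, 0, 123, 120⟩)]) ++
  [(cell (x + 1) 1, ⟨124, 122, 1, 0⟩), (cell (x + 1) 2, ⟨125, 0, 124, 0⟩),
    (cell (x + 1) 3, ⟨126, 0, 125, 0⟩)]

/-- The crenellated run from the wall at column `x` to the hook, with glues starting at `g`,
entered through the tile with west and north glues `a` and `b`. -/
def inward (x g a b : ℕ) : List (ℕ × Quad) :=
  (cell (x + 1) 4, ⟨b, g, 126, a⟩) ::
  (List.range 22).flatMap (fun i =>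
    [(cell (x + 2 + 2 * i) 4, ⟨colGlue 5, 0, g + 1, g⟩),
      (cell (x + 2 + 2 * i) 3, ⟨g + 1, g + 2, 0, 0⟩)] ++
    if i = 21 then [] else
      [(cell (x + 3 + 2 * i) 3, ⟨g + 3, 1, 0, g + 2⟩),
        (cell (x + 3 + 2 * i) 4, ⟨colGlue 5, g, g + 3, 0⟩)]) ++
  [(cell (x + 45) 3, ⟨g + 4, 0, 1, g + 2⟩), (cell (x + 45) 4, ⟨colGlue 5, g + 5, g + 4, 0⟩),
    (cell (x + 46) 4, ⟨colGlue 5, g + 6, 0, g + 5⟩)]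

/-- The passage over the first hook, and the second wall. -/
def secondWall : List (ℕ × Quad) :=
  [(cell 48 4, ⟨140, 0, 0, 136⟩), (cell 48 5, ⟨141, 0, 140, 0⟩),
    (cell 48 6, ⟨colGlue 7, 142, 141, 0⟩), (cell 49 6, ⟨colGlue 7, 143, 0, 142⟩),
    (cell 50 6, ⟨colGlue 7, 0, 144, 143⟩), (cell 50 5, ⟨144, 0, 0, 145⟩),
    (cell 49 5, ⟨0, 145, 146, 0⟩), (cell 49 4, ⟨146, 1, 102, 0⟩)] ++ wallFoot 49

/-- The cells of the gadget with their tiles, in the order of assembly. -/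
def path : List (ℕ × Quad) :=
  firstWall ++ outward 1 ++ inward 1 130 1 0 ++ secondWall ++ outward 49 ++ inward 49 150 0 1 ++
    [(cell 96 4, ⟨colGlue 5, 0, 0, 156⟩)]

/-- The number of the cell next to a cell, where this is a cell. -/
def next (c : ℕ) : Fin 4 → ℕ
  | 0 => c + 1
  | 1 => c + 8
  | 2 => c - 1
  | 3 => c - 8

/-- The cells of the path, packed into the digits of a single number for fast access. -/
def cellCode : ℕ := path.foldr (fun e a => e.1 + 1024 * a) 0

/-- The tiles of the path, packed into the digits of a single number for fast access. -/
def quadCode : ℕ :=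
  path.foldr (fun e a => e.2.n + 2048 * (e.2.e + 2048 * (e.2.s + 2048 * (e.2.w + 2048 * a)))) 0

/-- The `i`-th cell of the gadget. -/
def pathCell (i : ℕ) : ℕ := cellCode / 1024 ^ i % 1024

/-- The `i`-th tile of the gadget. -/
def pathQuad (i : ℕ) : Quad :=
  ⟨quadCode / 2048 ^ (4 * i) % 2048, quadCode / 2048 ^ (4 * i + 1) % 2048,
    quadCode / 2048 ^ (4 * i + 2) % 2048, quadCode / 2048 ^ (4 * i + 3) % 2048⟩

/-- The tile types of the gadget. -/
def gadget : List Quad := ((List.range 488).map pathQuad).dedup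

/-- The positions of the cells on the path, packed into the digits of a single number. -/
def rankCode : ℕ := (path.foldr (fun e a => (a.1 - 1, a.2 + a.1 * 512 ^ e.1)) (488, 0)).2

/-- The position of a cell on the path, counted from `1`, or `0` if the cell is not on the path. -/
def rank (c : ℕ) : ℕ := rankCode / 512 ^ c % 512

lemma length_gadget : gadget.length = 94 := by decide +kernel

lemma pathCell_checks : ∀ i < 488, rank (pathCell i) = i + 1 ∧ 8 ≤ pathCell i ∧
    pathCell i < 776 ∧ pathCell i % 8 < 7 ∧
    (pathCell i % 8 = 0 ∨ rank (pathCell i - 1) ≠ 0) := by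
  decide +kernel

lemma rank_checks : ∀ c < 784, rank c ≠ 0 → rank c ≤ 488 ∧ pathCell (rank c - 1) = c := by
  decide +kernel

lemma parent_checks : ∀ i < 488, i ≠ 0 → ∃ d, next (pathCell i) d = pathCell (i - 1) ∧
    2 ≤ (pathQuad i).side d ∧ (pathQuad i).side d < 1000 ∧
    (pathQuad (i - 1)).side (d + 2) = (pathQuad i).side d := by
  decide +kernel

lemma emission_checks : ∀ i < 488, ∀ d, (pathQuad i).side d < 2 ∨
    (i ≠ 0 ∧ next (pathCell i) d = pathCell (i - 1)) ∨
    (i + 1 < 488 ∧ next (pathCell i) d = pathCell (i + 1)) ∨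
    (d = 0 ∧ (pathQuad i).n = colGlue (pathCell i % 8 + 1) ∧ rank (pathCell i + 1) = 0) ∨
    (d = 3 ∧ (pathQuad i).w = rowGlue 1 ∧
      (pathCell i = 8 ∨ rank (pathCell i - 8) ≠ 0 ∧ rank (pathCell i - 8) ≤ i)) := by
  decide +kernel

lemma top_checks : ∀ i < 488, rank (pathCell i + 1) = 0 →
    (pathQuad i).n = colGlue (pathCell i % 8 + 1) := by
  decide +kernel

lemma calm_checks : ∀ i < 488, ∀ d, (pathQuad i).side d = 1 →
    rank (next (pathCell i) d) ≠ 0 →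
      (pathQuad (rank (next (pathCell i) d) - 1)).side (d + 2) ≠ 1 := by
  decide +kernel

/-- At the `i`-th step of the path, `t` is repelled by an earlier tile of the path. -/
def Repelled (i : ℕ) (t : Quad) : Prop :=
  ∃ v, t.side v = 1 ∧ rank (next (pathCell i) v) ≠ 0 ∧ rank (next (pathCell i) v) ≤ i ∧
    (pathQuad (rank (next (pathCell i) v) - 1)).side (v + 2) = 1

instance (i : ℕ) : DecidablePred (Repelled i) := fun t => by
  unfold Repelled
  infer_instance

lemma fork_checks : ∀ i < 488, ∀ d, i ≠ 0 → next (pathCell i) d = pathCell (i - 1) →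
    ∀ t ∈ gadget, t.side d = (pathQuad i).side d → t = pathQuad i ∨ Repelled i t := by
  decide +kernel

lemma bottom_checks : ∀ x < 96, rank (8 * (x + 1)) ≠ 0 := by decide +kernel

lemma gadget_checks : ∀ t ∈ gadget, t.e < 1000 ∧ t.s < 1000 := by decide +kernel
lemma gate_checks : pathCell 0 = 21 ∧ pathCell 6 = 8 ∧ (pathQuad 6).w = rowGlue 1 ∧
    (pathQuad 0).s = 1 := by
  decide +kernel

lemma path_mem_gadget {i : ℕ} (hi : i < 488) : pathQuad i ∈ gadget := by
  simpa [gadget] using ⟨i, hi, rfl⟩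

lemma colQuad_side (y : ℕ) (d : Fin 4) : (colQuad y).side d = 0 ∨ 1000 ≤ (colQuad y).side d := by
  fin_cases d <;> simp [colQuad, Quad.side, colGlue]

lemma rowQuad_side (j : ℕ) (d : Fin 4) : (rowQuad j).side d = 0 ∨ 1000 ≤ (rowQuad j).side d := by
  fin_cases d <;> simp [rowQuad, Quad.side, colGlue, rowGlue] <;> omega

/-- The tile types of the system that builds the square of side `K + 96`. -/
def tileSet (K : ℕ) : Finset Quad :=
  gadget.toFinset ∪ (Finset.Icc 1 (K + 95)).image colQuad ∪ (Finset.Icc 1 K).image rowQuad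

lemma mem_tileSet {K : ℕ} {t : Quad} : t ∈ tileSet K ↔ t ∈ gadget ∨
    (∃ y, (1 ≤ y ∧ y ≤ K + 95) ∧ colQuad y = t) ∨ ∃ j, (1 ≤ j ∧ j ≤ K) ∧ rowQuad j = t := by
  simp [tileSet]

lemma card_tileSet (K : ℕ) : (tileSet K).card ≤ 2 * K + 189 := by
  have h1 : gadget.toFinset.card ≤ 94 := length_gadget ▸ gadget.toFinset_card_le
  have h2 : ((Finset.Icc 1 (K + 95)).image colQuad).card ≤ K + 95 := by
    simpa using Finset.card_image_le (s := Finset.Icc 1 (K + 95)) (f := colQuad)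
  have h3 : ((Finset.Icc 1 K).image rowQuad).card ≤ K := by
    simpa using Finset.card_image_le (s := Finset.Icc 1 K) (f := rowQuad)
  have h4 := Finset.card_union_le gadget.toFinset ((Finset.Icc 1 (K + 95)).image colQuad)
  have h5 := Finset.card_union_le (gadget.toFinset ∪ (Finset.Icc 1 (K + 95)).image colQuad)
    ((Finset.Icc 1 K).image rowQuad)
  rw [tileSet]
  omega

lemma eq_colQuad_of_south {K y : ℕ} {t : Quad} (ht : t ∈ tileSet K) (h : t.s = colGlue y) :
    t = colQuad y ∧ y ≤ K + 95 := by
  rcases mem_tileSet.1 ht with ht | ⟨z, hz, rfl⟩ | ⟨j, hj, rfl⟩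
  · have := (gadget_checks t ht).2
    simp only [colGlue] at h
    omega
  · simp only [colQuad, colGlue] at h
    obtain rfl : z = y := by omega
    exact ⟨rfl, hz.2⟩
  · simp only [rowQuad, colGlue] at h
    omega

lemma eq_rowQuad_of_east {K j : ℕ} {t : Quad} (ht : t ∈ tileSet K) (h : t.e = rowGlue j) :
    t = rowQuad j ∧ j ≤ K := by
  rcases mem_tileSet.1 ht with ht | ⟨z, hz, rfl⟩ | ⟨i, hi, rfl⟩
  · have := (gadget_checks t ht).1
    simp only [rowGlue] at h
    omega
  · simp only [colQuad, rowGlue] at h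
    omega
  · simp only [rowQuad, rowGlue] at h
    obtain rfl : i = j := by omega
    exact ⟨rfl, hi.2⟩

lemma add_north (a b : ℤ) : ((a, b) : Pos) + dir 0 = (a, b + 1) := by simp [dir]

lemma add_east (a b : ℤ) : ((a, b) : Pos) + dir 1 = (a + 1, b) := by simp [dir]

lemma add_south (a b : ℤ) : ((a, b) : Pos) + dir 2 = (a, b - 1) := by simp [dir, sub_eq_add_neg]

lemma add_west (a b : ℤ) : ((a, b) : Pos) + dir 3 = (a - 1, b) := by simp [dir, sub_eq_add_neg]

/-- The position in the plane of a cell of the gadget; the seed is at the origin. -/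
def pos (c : ℕ) : Pos := ((c / 8 : ℕ) - 2, (c % 8 : ℕ) - 5)

lemma pos_injective : Function.Injective pos := by
  intro c c' h
  simp only [pos, Prod.mk.injEq] at h
  omega

lemma pos_eq_add_dir {c c' : ℕ} {d : Fin 4} (hc : 8 ≤ c) (h7 : c % 8 < 7) (h7' : c' % 8 < 7) :
    pos c' = pos c + dir d ↔ next c d = c' := by
  fin_cases d
  · show pos c' = pos c + dir 0 ↔ c + 1 = c'
    simp only [pos, add_north, Prod.mk.injEq]
    omega
  · show pos c' = pos c + dir 1 ↔ c + 8 = c'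
    simp only [pos, add_east, Prod.mk.injEq]
    omega
  · show pos c' = pos c + dir 2 ↔ c - 1 = c'
    simp only [pos, add_south, Prod.mk.injEq]
    omega
  · show pos c' = pos c + dir 3 ↔ c - 8 = c'
    simp only [pos, add_west, Prod.mk.injEq]
    omega

/-- The position of the `i`-th cell of the gadget. -/
def pathPos (i : ℕ) : Pos := pos (pathCell i)

lemma pathPos_zero : pathPos 0 = 0 := by
  rw [pathPos, gate_checks.1]
  rfl

lemma pathPos_inj {i j : ℕ} (hi : i < 488) (hj : j < 488) (h : pathPos i = pathPos j) :
    i = j := by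
  have h1 := (pathCell_checks i hi).1
  have h2 := (pathCell_checks j hj).1
  rw [pos_injective h] at h1
  omega

lemma pathPos_adj {i j : ℕ} {d : Fin 4} (hi : i < 488) (hj : j < 488) :
    pathPos j = pathPos i + dir d ↔ next (pathCell i) d = pathCell j :=
  pos_eq_add_dir (pathCell_checks i hi).2.1 (pathCell_checks i hi).2.2.2.1
    (pathCell_checks j hj).2.2.2.1

lemma next_lt {i : ℕ} (hi : i < 488) (d : Fin 4) : next (pathCell i) d < 784 := by
  have := (pathCell_checks i hi).2.2.1
  fin_cases d <;> simp only [next] <;> omega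

/-- The position `p` is not a cell of the gadget. -/
def Off (p : Pos) : Prop := ∀ i < 488, pathPos i ≠ p

lemma not_off {p : Pos} (h : ¬ Off p) : ∃ i < 488, pathPos i = p := by
  simpa [Off] using h

lemma Off.north {a b : ℤ} (h : Off (a, b)) (hb : -5 ≤ b) : Off (a, b + 1) := by
  intro i hi h1
  obtain ⟨-, h8, h776, h7, h0⟩ := pathCell_checks i hi
  simp only [pathPos, pos, Prod.mk.injEq] at h1
  have h2 := rank_checks (pathCell i - 1) (by omega) (h0.resolve_left (by omega))
  refine h (rank (pathCell i - 1) - 1) (by omega) ?_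
  rw [pathPos, h2.2]
  simp only [pos, Prod.mk.injEq]
  omega

lemma exists_bottom {a : ℤ} (h1 : -1 ≤ a) (h2 : a ≤ 94) : ∃ i < 488, pathPos i = (a, -5) := by
  obtain ⟨x, rfl⟩ : ∃ x : ℕ, a = x - 1 := ⟨(a + 1).toNat, by omega⟩
  have h3 := bottom_checks x (by omega)
  have h4 := rank_checks _ (by omega) h3
  refine ⟨rank (8 * (x + 1)) - 1, by omega, ?_⟩
  rw [pathPos, h4.2]
  simp only [pos, Prod.mk.injEq]
  omega

lemma off_of_lt {a b : ℤ} (h : a < -1) : Off (a, b) := by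
  intro i hi h1
  have := (pathCell_checks i hi).2.1
  simp only [pathPos, pos, Prod.mk.injEq] at h1
  omega

lemma off_of_rank {i : ℕ} (hi : i < 488) {d : Fin 4} (h : rank (next (pathCell i) d) = 0) :
    Off (pathPos i + dir d) := by
  intro j hj h1
  rw [(pathPos_adj hi hj).1 h1, (pathCell_checks j hj).1] at h
  omega

open Classical in
/-- The tiles of the square of side `K + 96`. -/
noncomputable def squareTgt (K : ℕ) (p : Pos) : Option Quad :=
  if h : ∃ i < 488, pathPos i = p then some (pathQuad h.choose)
  else if -1 - (K : ℤ) ≤ p.1 ∧ p.1 ≤ 94 ∧ -5 ≤ p.2 ∧ p.2 < K + 91 then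
    some (if p.2 = -5 then rowQuad (-1 - p.1).toNat else colQuad (p.2 + 5).toNat)
  else none

open Classical in
/-- The position to which the tile at `p` attaches. -/
noncomputable def squarePar (p : Pos) : Pos :=
  if h : ∃ i < 488, pathPos i = p then pathPos (h.choose - 1)
  else if p.2 = -5 then p + dir 1 else p + dir 2

lemma squareTgt_path (K : ℕ) {i : ℕ} (hi : i < 488) :
    squareTgt K (pathPos i) = some (pathQuad i) := by
  have h : ∃ j < 488, pathPos j = pathPos i := ⟨i, hi, rfl⟩
  rw [squareTgt, dif_pos h, pathPos_inj h.choose_spec.1 hi h.choose_spec.2]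

lemma squarePar_path {i : ℕ} (hi : i < 488) : squarePar (pathPos i) = pathPos (i - 1) := by
  have h : ∃ j < 488, pathPos j = pathPos i := ⟨i, hi, rfl⟩
  rw [squarePar, dif_pos h, pathPos_inj h.choose_spec.1 hi h.choose_spec.2]

lemma squarePar_iterate {i : ℕ} (hi : i < 488) (k : ℕ) :
    squarePar^[k] (pathPos i) = pathPos (i - k) := by
  induction k with
  | zero => rfl
  | succ k ih =>
    rw [Function.iterate_succ_apply', ih, squarePar_path (by omega)]
    congr 1

lemma exists_iterate {i j : ℕ} (hi : i < 488) (hj : j ≤ i) :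
    ∃ k, squarePar^[k] (pathPos i) = pathPos j :=
  ⟨i - j, by rw [squarePar_iterate hi]; congr 1; omega⟩

lemma squareTgt_col {K y : ℕ} {a : ℤ} (h : Off (a, (y : ℤ) - 5)) (hy : 1 ≤ y)
    (hyK : y ≤ K + 95) (ha : -1 - (K : ℤ) ≤ a) (ha' : a ≤ 94) :
    squareTgt K (a, (y : ℤ) - 5) = some (colQuad y) := by
  rw [squareTgt, dif_neg (by simpa [Off] using h), if_pos ⟨ha, ha', by simp, by simp; omega⟩,
    if_neg (by simp; omega)]
  simp

lemma squarePar_col {y : ℕ} {a : ℤ} (h : Off (a, (y : ℤ) - 5)) (hy : 1 ≤ y) :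
    squarePar (a, (y : ℤ) - 5) = (a, (y : ℤ) - 5) + dir 2 := by
  rw [squarePar, dif_neg (by simpa [Off] using h), if_neg (by simp; omega)]

lemma squareTgt_row {K j : ℕ} (hj : 1 ≤ j) (hjK : j ≤ K) :
    squareTgt K (-1 - (j : ℤ), -5) = some (rowQuad j) := by
  have h : Off (-1 - (j : ℤ), -5) := off_of_lt (by omega)
  rw [squareTgt, dif_neg (by simpa [Off] using h),
    if_pos ⟨by simp; omega, by simp; omega, by simp, by simp; omega⟩, if_pos rfl]
  simp

lemma squarePar_row {j : ℕ} (hj : 1 ≤ j) :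
    squarePar (-1 - (j : ℤ), -5) = (-1 - (j : ℤ), -5) + dir 1 := by
  have h : Off (-1 - (j : ℤ), -5) := off_of_lt (by omega)
  rw [squarePar, dif_neg (by simpa [Off] using h), if_pos rfl]

lemma squareTgt_cases {K : ℕ} {p : Pos} {q : Quad} (h : squareTgt K p = some q) :
    (∃ i < 488, p = pathPos i ∧ q = pathQuad i) ∨
    (∃ (a : ℤ) (y : ℕ), p = (a, (y : ℤ) - 5) ∧ Off (a, (y : ℤ) - 5) ∧ 1 ≤ y ∧ y ≤ K + 95 ∧
      -1 - (K : ℤ) ≤ a ∧ a ≤ 94 ∧ q = colQuad y) ∨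
    ∃ j : ℕ, p = (-1 - (j : ℤ), -5) ∧ 1 ≤ j ∧ j ≤ K ∧ q = rowQuad j := by
  by_cases h1 : ∃ i < 488, pathPos i = p
  · obtain ⟨i, hi, rfl⟩ := h1
    rw [squareTgt_path K hi] at h
    exact Or.inl ⟨i, hi, rfl, (Option.some.inj h).symm⟩
  have hoff : Off p := by simpa [Off] using h1
  rw [squareTgt, dif_neg h1] at h
  obtain ⟨a, b⟩ := p
  split_ifs at h with h2 h3
  · dsimp only at h2 h3
    subst h3
    have ha : a < -1 := by
      by_contra! ha
      exact h1 (exists_bottom ha h2.2.1)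
    obtain ⟨j, rfl⟩ : ∃ j : ℕ, a = -1 - j := ⟨(-1 - a).toNat, by omega⟩
    refine Or.inr (Or.inr ⟨j, rfl, by omega, by omega, ?_⟩)
    simpa using h.symm
  · dsimp only at h2 h3
    obtain ⟨y, rfl⟩ : ∃ y : ℕ, b = y - 5 := ⟨(b + 5).toNat, by omega⟩
    refine Or.inr (Or.inl ⟨a, y, rfl, hoff, by omega, by omega, h2.1, h2.2.1, ?_⟩)
    simpa using h.symm

lemma squareTgt_ne_none {K : ℕ} {p : Pos} : squareTgt K p ≠ none ↔
    -1 - (K : ℤ) ≤ p.1 ∧ p.1 ≤ 94 ∧ -5 ≤ p.2 ∧ p.2 < K + 91 := by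
  by_cases h : ∃ i < 488, pathPos i = p
  · obtain ⟨i, hi, rfl⟩ := h
    have := pathCell_checks i hi
    simp only [squareTgt_path K hi, ne_eq, reduceCtorEq, not_false_eq_true, true_iff]
    simp only [pathPos, pos]
    omega
  · rw [squareTgt, dif_neg h]
    split_ifs with h1
    · exact iff_of_true (by simp) h1
    · exact iff_of_true (by simp) h1
    · exact iff_of_false (by simp) h1

/-- Every column tile sits on a tile with the right north glue. -/
lemma col_support {K y : ℕ} {a : ℤ} (h : Off (a, (y : ℤ) - 5)) (hy : 1 ≤ y)
    (hyK : y ≤ K + 95) (ha : -1 - (K : ℤ) ≤ a) (ha' : a ≤ 94) :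
    ∃ q, squareTgt K ((a, (y : ℤ) - 5) + dir 2) = some q ∧ q.n = colGlue y := by
  by_cases h1 : Off ((a, (y : ℤ) - 5) + dir 2)
  · rw [add_south] at h1 ⊢
    rcases hy.eq_or_lt with rfl | hy
    · have h2 : a < -1 := by
        by_contra! h2
        obtain ⟨i, hi, hp⟩ := exists_bottom h2 ha'
        exact h1 i hi (hp.trans (by norm_num))
      obtain ⟨j, rfl⟩ : ∃ j : ℕ, a = -1 - j := ⟨(-1 - a).toNat, by omega⟩
      exact ⟨rowQuad j, by simpa using squareTgt_row (by omega) (by omega), rfl⟩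
    · obtain ⟨z, rfl⟩ : ∃ z, y = z + 1 := ⟨y - 1, by omega⟩
      have hz : ((z + 1 : ℕ) : ℤ) - 5 - 1 = (z : ℤ) - 5 := by omega
      rw [hz] at h1 ⊢
      exact ⟨colQuad z, squareTgt_col h1 (by omega) (by omega) ha ha', rfl⟩
  · obtain ⟨i, hi, h2⟩ := not_off h1
    rw [← h2]
    refine ⟨_, squareTgt_path K hi, ?_⟩
    have h3 : pathPos i + dir 0 = (a, (y : ℤ) - 5) := by
      rw [h2, add_assoc, add_comm (dir 2), show dir 0 + dir 2 = 0 from dir_add_two 0, add_zero]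
    rw [top_checks i hi]
    · rw [pathPos, pos, add_north, Prod.mk.injEq] at h3
      congr 1
      omega
    · by_contra hr
      have h4 := rank_checks _ (next_lt hi 0) hr
      have h5 : rank (next (pathCell i) 0) - 1 < 488 := by omega
      refine h _ h5 (h3 ▸ (pathPos_adj hi h5).2 h4.2.symm)

/-- Every tile of the bottom row is next to a tile with the right west glue. -/
lemma row_support {K j : ℕ} (hj : 1 ≤ j) (hjK : j ≤ K) :
    ∃ q, squareTgt K ((-1 - (j : ℤ), -5) + dir 1) = some q ∧ q.w = rowGlue j := by
  rw [add_east]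
  rcases hj.eq_or_lt with rfl | hj
  · have : ((-1 - ((1 : ℕ) : ℤ) + 1, -5) : Pos) = pathPos 6 := by
      rw [pathPos, gate_checks.2.1]
      rfl
    rw [this]
    exact ⟨_, squareTgt_path K (by norm_num), gate_checks.2.2.1⟩
  · obtain ⟨z, rfl⟩ : ∃ z, j = z + 1 := ⟨j - 1, by omega⟩
    have hz : -1 - ((z + 1 : ℕ) : ℤ) + 1 = -1 - (z : ℤ) := by omega
    rw [hz]
    exact ⟨rowQuad z, squareTgt_row (by omega) (by omega), rfl⟩

lemma ne_zero_of_pathPos {i : ℕ} (h : pathPos i ≠ 0) : i ≠ 0 := by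
  rintro rfl
  exact h pathPos_zero

lemma path_parent {i : ℕ} (hi : i < 488) (h0 : i ≠ 0) : ∃ d, pathPos (i - 1) = pathPos i + dir d ∧
    2 ≤ (pathQuad i).side d ∧ (pathQuad i).side d < 1000 ∧
    (pathQuad (i - 1)).side (d + 2) = (pathQuad i).side d := by
  obtain ⟨d, h1, h2⟩ := parent_checks i hi h0
  exact ⟨d, (pathPos_adj hi (by omega)).2 h1, h2⟩

lemma square_chain {K : ℕ} {p : Pos} (hp : squareTgt K p ≠ none) :
    ∃ k, squarePar^[k] p = 0 := by
  have gad : ∀ p, ¬ Off p → ∃ k, squarePar^[k] p = 0 := by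
    intro p h
    obtain ⟨i, hi, rfl⟩ := not_off h
    exact pathPos_zero ▸ exists_iterate hi (Nat.zero_le _)
  have row : ∀ j : ℕ, ∃ k, squarePar^[k] (-1 - (j : ℤ), -5) = 0 := by
    intro j
    induction j with
    | zero =>
      obtain ⟨i, hi, h⟩ := exists_bottom (a := -1) le_rfl (by norm_num)
      exact gad _ fun h' => h' i hi (by rw [h]; simp)
    | succ j ih =>
      obtain ⟨k, hk⟩ := ih
      refine ⟨k + 1, ?_⟩
      rw [Function.iterate_succ_apply, squarePar_row (by omega), add_east]
      convert hk using 3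
      push_cast
      ring
  have col : ∀ (y : ℕ) (a : ℤ), a ≤ 94 → ∃ k, squarePar^[k] (a, (y : ℤ) - 5) = 0 := by
    intro y a ha
    induction y with
    | zero =>
      by_cases h1 : a < -1
      · obtain ⟨j, rfl⟩ : ∃ j : ℕ, a = -1 - j := ⟨(-1 - a).toNat, by omega⟩
        simpa using row j
      · obtain ⟨i, hi, h⟩ := exists_bottom (not_lt.1 h1) ha
        exact gad _ fun h' => h' i hi (by rw [h]; simp)
    | succ y ih =>
      by_cases h : Off (a, ((y + 1 : ℕ) : ℤ) - 5)
      · obtain ⟨k, hk⟩ := ih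
        refine ⟨k + 1, ?_⟩
        rw [Function.iterate_succ_apply, squarePar_col h (by omega), add_south]
        convert hk using 3
        push_cast
        ring
      · exact gad _ h
  obtain ⟨a, b⟩ := p
  obtain ⟨-, h2, h3, -⟩ := squareTgt_ne_none.1 hp
  dsimp only at h2 h3
  obtain ⟨y, rfl⟩ : ∃ y : ℕ, b = y - 5 := ⟨(b + 5).toNat, by omega⟩
  exact col y a h2

lemma square_par_spec {K : ℕ} {p : Pos} {q : Quad} (h : squareTgt K p = some q) (hp : p ≠ 0) :
    ∃ d q', squarePar p = p + dir d ∧ squareTgt K (p + dir d) = some q' ∧ 2 ≤ q.side d ∧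
      q'.side (d + 2) = q.side d := by
  rcases squareTgt_cases h with ⟨i, hi, rfl, rfl⟩ | ⟨a, y, rfl, h1, h2, h3, h4, h5, rfl⟩ |
    ⟨j, rfl, h1, h2, rfl⟩
  · obtain ⟨d, h1, h2, -, h3⟩ := path_parent hi (ne_zero_of_pathPos hp)
    exact ⟨d, _, by rw [squarePar_path hi, h1], h1 ▸ squareTgt_path K (by omega), h2, h3⟩
  · obtain ⟨q', h6, h7⟩ := col_support h1 h2 h3 h4 h5
    exact ⟨2, q', squarePar_col h1 h2, h6, by simp [Quad.side, colQuad, colGlue]; omega, h7⟩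
  · obtain ⟨q', h6, h7⟩ := row_support h1 h2
    exact ⟨1, q', squarePar_row h1, h6, by simp [Quad.side, rowQuad, rowGlue]; omega, h7⟩

/-- A column tile is the child of the tile below it. -/
lemma square_child_north {K : ℕ} {a b : ℤ} (h : Off (a, b + 1)) (hb : -5 ≤ b)
    (hb' : b + 1 < K + 91) (ha : -1 - (K : ℤ) ≤ a) (ha' : a ≤ 94) :
    squareTgt K ((a, b) + dir 0) ≠ none ∧ squarePar ((a, b) + dir 0) = (a, b) := by
  obtain ⟨y, rfl⟩ : ∃ y : ℕ, b = ((y + 1 : ℕ) : ℤ) - 5 - 1 := ⟨(b + 5).toNat, by omega⟩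
  rw [add_north, sub_add_cancel] at *
  refine ⟨by rw [squareTgt_col h (by omega) (by omega) ha ha']; simp, ?_⟩
  rw [squarePar_col h (by omega), add_south]

lemma square_emit {K : ℕ} (hK : 1 ≤ K) {p : Pos} {q : Quad} {d : Fin 4}
    (h : squareTgt K p = some q) (hd : 2 ≤ q.side d) :
    (∃ k, squarePar^[k] p = p + dir d) ∨
    (squareTgt K (p + dir d) ≠ none ∧ squarePar (p + dir d) = p) ∨
    ∀ t ∈ tileSet K, t.side (d + 2) ≠ q.side d := by
  rcases squareTgt_cases h with ⟨i, hi, rfl, rfl⟩ | ⟨a, y, rfl, h1, h2, h3, h4, h5, rfl⟩ |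
    ⟨j, rfl, h1, h2, rfl⟩
  · have hc := pathCell_checks i hi
    rcases emission_checks i hi d with h1 | ⟨h1, h2⟩ | ⟨h1, h2⟩ | ⟨rfl, -, h2⟩ | ⟨rfl, -, h2⟩
    · omega
    · rw [← (pathPos_adj hi (by omega)).2 h2]
      exact Or.inl (exists_iterate hi (by omega))
    · rw [← (pathPos_adj hi (by omega)).2 h2]
      refine Or.inr (Or.inl ⟨by simp [squareTgt_path K h1], ?_⟩)
      rw [squarePar_path h1, Nat.add_sub_cancel]
    · have h3 : Off (pathPos i + dir 0) := off_of_rank hi h2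
      rw [pathPos, pos] at h3 ⊢
      rw [add_north] at h3
      exact Or.inr (Or.inl (square_child_north h3 (by omega) (by omega) (by omega) (by omega)))
    · rcases h2 with h2 | ⟨h2, h3⟩
      · have h4 : pathPos i + dir 3 = (-1 - ((1 : ℕ) : ℤ), -5) := by
          rw [pathPos, h2]
          rfl
        refine Or.inr (Or.inl ?_)
        rw [h4]
        refine ⟨by rw [squareTgt_row le_rfl hK]; simp, ?_⟩
        rw [squarePar_row le_rfl, ← h4, add_assoc, show dir 3 + dir 1 = 0 from dir_add_two 3,
          add_zero]
      · have h4 := rank_checks _ (next_lt hi 3) h2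
        have h5 : rank (next (pathCell i) 3) - 1 < 488 := by omega
        rw [← (pathPos_adj hi h5).2 h4.2.symm]
        refine Or.inl (exists_iterate hi ?_)
        change rank (pathCell i - 8) - 1 ≤ i
        omega
  · fin_cases d
    · by_cases hy : y = K + 95
      · refine Or.inr (Or.inr fun t ht h6 => ?_)
        have := (eq_colQuad_of_south ht h6).2
        omega
      · exact Or.inr (Or.inl (square_child_north (h1.north (by omega)) (by omega) (by omega) h4 h5))
    · simp [Quad.side, colQuad] at hd
    · exact Or.inl ⟨1, squarePar_col h1 h2⟩
    · simp [Quad.side, colQuad] at hd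
  · fin_cases d
    · exact Or.inr (Or.inl (square_child_north (off_of_lt (by omega)) le_rfl (by omega) (by omega)
        (by omega)))
    · exact Or.inl ⟨1, squarePar_row h1⟩
    · simp [Quad.side, rowQuad] at hd
    · by_cases hj : j = K
      · refine Or.inr (Or.inr fun t ht h6 => ?_)
        have := (eq_rowQuad_of_east ht h6).2
        omega
      · refine Or.inr (Or.inl ?_)
        show squareTgt K ((-1 - (j : ℤ), -5) + dir 3) ≠ none ∧
          squarePar ((-1 - (j : ℤ), -5) + dir 3) = (-1 - (j : ℤ), -5)
        have h6 : -1 - (j : ℤ) - 1 = -1 - ((j + 1 : ℕ) : ℤ) := by push_cast; ring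
        rw [add_west, h6]
        refine ⟨by rw [squareTgt_row (by omega) (by omega)]; simp, ?_⟩
        rw [squarePar_row (by omega), add_east, ← h6, sub_add_cancel]

lemma square_fork {K : ℕ} {p : Pos} {q q' t : Quad} {d : Fin 4} (h : squareTgt K p = some q)
    (hp : p ≠ 0) (hpar : squarePar p = p + dir d) (h' : squareTgt K (p + dir d) = some q')
    (ht : t ∈ tileSet K) (hg : 2 ≤ t.side d) (htd : t.side d = q'.side (d + 2)) :
    t = q ∨ ∃ v r, t.side v = 1 ∧ squareTgt K (p + dir v) = some r ∧ r.side (v + 2) = 1 ∧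
      ∃ k, squarePar^[k] p = p + dir v := by
  rcases squareTgt_cases h with ⟨i, hi, rfl, rfl⟩ | ⟨a, y, rfl, h1, h2, h3, h4, h5, rfl⟩ |
    ⟨j, rfl, h1, h2, rfl⟩
  · have h0 := ne_zero_of_pathPos hp
    obtain ⟨d', h1, h2, h3, h4⟩ := path_parent hi h0
    rw [squarePar_path hi] at hpar
    obtain rfl : d' = d := dir_injective (add_left_cancel (h1.symm.trans hpar))
    rw [← h1, squareTgt_path K (by omega), Option.some.injEq] at h'
    subst h'
    rw [h4] at htd
    rcases mem_tileSet.1 ht with ht | ⟨y, -, rfl⟩ | ⟨j, -, rfl⟩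
    · rcases fork_checks i hi d' h0 ((pathPos_adj hi (by omega)).1 h1) t ht htd with
        h5 | ⟨v, h5, h6, h7, h8⟩
      · exact Or.inl h5
      · have h9 := rank_checks _ (next_lt hi v) h6
        have h10 : rank (next (pathCell i) v) - 1 < 488 := by omega
        refine Or.inr ⟨v, _, h5, ?_, h8, ?_⟩
        · rw [← (pathPos_adj hi h10).2 h9.2.symm, squareTgt_path K h10]
        · rw [← (pathPos_adj hi h10).2 h9.2.symm]
          exact exists_iterate hi (by omega)
    · have := colQuad_side y d'
      omega
    · have := rowQuad_side j d'
      omega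
  · rw [squarePar_col h1 h2] at hpar
    obtain rfl : 2 = d := dir_injective (add_left_cancel hpar)
    obtain ⟨r, h6, h7⟩ := col_support h1 h2 h3 h4 h5
    obtain rfl : r = q' := Option.some.inj (h6.symm.trans h')
    exact Or.inl (eq_colQuad_of_south ht (htd.trans h7)).1
  · rw [squarePar_row h1] at hpar
    obtain rfl : 1 = d := dir_injective (add_left_cancel hpar)
    obtain ⟨r, h6, h7⟩ := row_support h1 h2
    obtain rfl : r = q' := Option.some.inj (h6.symm.trans h')
    exact Or.inl (eq_rowQuad_of_east ht (htd.trans h7)).1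

lemma square_path_of_side {K : ℕ} {p : Pos} {q : Quad} {d : Fin 4} (h : squareTgt K p = some q)
    (hd : q.side d = 1) : ∃ i < 488, p = pathPos i ∧ q = pathQuad i := by
  rcases squareTgt_cases h with h | ⟨a, y, -, -, -, -, -, -, rfl⟩ | ⟨j, -, -, -, rfl⟩
  · exact h
  · have := colQuad_side y d
    omega
  · have := rowQuad_side j d
    omega

lemma square_calm {K : ℕ} {p : Pos} {q q' : Quad} {d : Fin 4} (h : squareTgt K p = some q)
    (h' : squareTgt K (p + dir d) = some q') (hd : q.side d = 1) : q'.side (d + 2) ≠ 1 := by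
  intro hd'
  obtain ⟨i, hi, rfl, rfl⟩ := square_path_of_side h hd
  obtain ⟨j, hj, h1, rfl⟩ := square_path_of_side h' hd'
  have h2 := calm_checks i hi d hd
  rw [(pathPos_adj hi hj).1 h1.symm, (pathCell_checks j hj).1] at h2
  exact h2 (by omega) hd'

/-- The blueprint of the square of side `K + 96`. -/
noncomputable def squareBlueprint (K : ℕ) (hK : 1 ≤ K) : Blueprint where
  tiles := tileSet K
  tgt := squareTgt K
  par := squarePar
  seed := pathQuad 0
  tgt_zero := pathPos_zero ▸ squareTgt_path K (by norm_num)
  par_zero := by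
    have := squarePar_path (i := 0) (by norm_num)
    rwa [pathPos_zero] at this
  mem_tiles h := by
    rw [mem_tileSet]
    rcases squareTgt_cases h with ⟨i, hi, -, rfl⟩ | ⟨a, y, -, -, h1, h2, -, -, rfl⟩ |
      ⟨j, -, h1, h2, rfl⟩
    · exact Or.inl (path_mem_gadget hi)
    · exact Or.inr (Or.inl ⟨y, ⟨h1, h2⟩, rfl⟩)
    · exact Or.inr (Or.inr ⟨j, ⟨h1, h2⟩, rfl⟩)
  finite := (Set.finite_Icc ((-1 - (K : ℤ), -5) : Pos) (94, (K : ℤ) + 91)).subset fun p hp => by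
    obtain ⟨h1, h2, h3, h4⟩ := squareTgt_ne_none.1 hp
    exact ⟨⟨h1, h3⟩, ⟨h2, h4.le⟩⟩
  chain := square_chain
  par_spec := square_par_spec
  emit := square_emit hK
  fork := square_fork
  calm := square_calm

lemma square_domain (K : ℕ) : {p | squareTgt K p ≠ none} =
    (fun p => p + (-1 - (K : ℤ), -5)) '' SN (K + 96) := by
  ext ⟨a, b⟩
  simp only [Set.mem_ofPred_eq, squareTgt_ne_none, Set.mem_image, SN, Prod.exists, Prod.mk_add_mk,
    Prod.mk.injEq]
  constructor
  · rintro ⟨h1, h2, h3, h4⟩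
    exact ⟨a + 1 + K, b + 5, by push_cast; omega, by omega, by omega⟩
  · rintro ⟨x, y, h, rfl, rfl⟩
    push_cast at h
    omega

end TA

open TA in
/-- For every sufficiently large `N` there is a directed rgTAS in which the
`N × N` square strictly self-assembles using fewer than `2N - 1` tile types:
the Rothemund–Winfree temperature-1 lower bound fails for glue-restricted systems. -/
theorem rgTAS_square_beats_RothemundWinfree_bound :
    ∃ N₀ : ℕ, ∀ N : ℕ, N₀ ≤ N →
      ∃ 𝒯 : TAS, IsRgTAS 𝒯 ∧ DirectedTAS 𝒯 ∧ StrictlySelfAssembles 𝒯 (SN N) ∧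
        𝒯.tiles.card < 2 * N - 1 := by
  refine ⟨97, fun N hN => ?_⟩
  obtain ⟨K, rfl⟩ : ∃ K, N = K + 96 := ⟨N - 96, by omega⟩
  let B := squareBlueprint K (by omega)
  refine ⟨B.tas, B.isRgTAS ⟨pathQuad 0, B.mem_tiles B.tgt_zero, 2, gate_checks.2.2.2⟩, B.directed,
    B.strictlySelfAssembles (square_domain K), ?_⟩
  have h1 := B.card_tas_tiles_le
  have h2 : B.tiles.card ≤ 2 * K + 189 := card_tileSet K
  omega
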